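/- arXiv:1606.06208 — 2 statements merged into one kernel-verified Lean document; each statement's English description precedes it below -/
import Mathlib

section
/- Let R ∈ SO(3) and let A be a symmetric real 3×3 matrix such that Ā = (tr(A)I − A)/2 is positive definite. Then 4 λ_min(Ā) |R|_I² ≤ tr(A(I − R)) ≤ 4 λ_max(Ā) |R|_I², where λ_min(Ā) and λ_max(Ā) are the smallest and largest eigenvalues of Ā. -/
open Matrix Filter

noncomputable section

attribute [local instance] Matrix.normedAddCommGroup Matrix.normedSpace

/-- 3×3 real matrices. -/
abbrev M3 := Matrix (Fin 3) (Fin 3) ℝ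
/-- vectors in ℝ³. -/
abbrev V3 := Fin 3 → ℝ

/-- `R ∈ SO(3)`: `RᵀR = I` and `det R = 1`. -/
def SO3 (R : M3) : Prop := Rᵀ * R = 1 ∧ R.det = 1

/-- The skew-symmetric matrix `[x]ₓ` with `[x]ₓ y = x × y`. -/
def skew (x : V3) : M3 :=
  !![0, -x 2, x 1; x 2, 0, -x 0; -x 1, x 0, 0]

/-- Inverse of `skew` on skew-symmetric matrices. -/
def vex (M : M3) : V3 := ![M 2 1, M 0 2, M 1 0]

/-- Anti-symmetric projection `P_a(M) = (M - Mᵀ)/2`. -/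
def Pa (M : M3) : M3 := (2:ℝ)⁻¹ • (M - Mᵀ)

/-- `ψ(M) = vex(P_a(M))`. -/
def psi (M : M3) : V3 := vex (Pa M)

/-- Squared normalized Euclidean distance `|R|_I² = tr(I - R)/4`. -/
def normI2 (R : M3) : ℝ := (1 - R).trace / 4

/-- Rodrigues vector `Z(R) = ψ(R)/(2(1 - |R|_I²))`. -/
def Zof (R : M3) : V3 := (2 * (1 - normI2 R))⁻¹ • psi R

/-- Cayley map `R_r(z) = (I + [z]ₓ)(I - [z]ₓ)⁻¹`. -/
def Rr (z : V3) : M3 := (1 + skew z) * (1 - skew z)⁻¹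

/-- Angle-axis map `R_a(θ,u) = I + sin θ [u]ₓ + (1 - cos θ)[u]ₓ²`. -/
def Ra (θ : ℝ) (u : V3) : M3 :=
  1 + Real.sin θ • skew u + (1 - Real.cos θ) • (skew u * skew u)

/-- `g(z) = (1/2)(I + [z]ₓ + z zᵀ)`. -/
def gmat (z : V3) : M3 := (2:ℝ)⁻¹ • ((1 : M3) + skew z + vecMulVec z z)

/-- `Ā = (tr(A) I - A)/2`. -/
def Abar (A : M3) : M3 := (2:ℝ)⁻¹ • (A.trace • (1 : M3) - A)

/-- smallest eigenvalue of a positive-definite symmetric real matrix. -/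
def lmin {B : M3} (hB : B.PosDef) : ℝ := ⨅ i, hB.1.eigenvalues i

/-- largest eigenvalue of a positive-definite symmetric real matrix. -/
def lmax {B : M3} (hB : B.PosDef) : ℝ := ⨆ i, hB.1.eigenvalues i

theorem adjugate_eq_sq_sub (M : M3) :
    M.adjugate = M * M - M.trace • M + M.adjugate.trace • (1 : M3) := by
  ext i j
  fin_cases i <;> fin_cases j <;>
    simp [adjugate_fin_three, trace_fin_three, mul_apply, Fin.sum_univ_three, one_apply] <;> ring

theorem SO3.adjugate_eq_transpose {R : M3} (hR : SO3 R) : R.adjugate = Rᵀ := by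
  have h : Rᵀ * (R * R.adjugate) = R.adjugate := by
    rw [← Matrix.mul_assoc, hR.1, Matrix.one_mul]
  rw [← h, mul_adjugate, hR.2, one_smul, Matrix.mul_one]

theorem SO3.trace_le_three {R : M3} (hR : SO3 R) : R.trace ≤ 3 := by
  have hd (i : Fin 3) : R i i ≤ 1 := by
    have h : ∑ k, R k i * R k i = 1 := by
      simpa [mul_apply] using congrFun₂ hR.1 i i
    have := Finset.single_le_sum (f := fun k => R k i * R k i)
      (fun k _ => mul_self_nonneg _) (Finset.mem_univ i)
    nlinarith
  rw [trace_fin_three]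
  linarith [hd 0, hd 1, hd 2]

/-- For a rotation by `θ` about the unit vector `u`, this is `2 (1 - cos θ) u uᵀ`. -/
def axisMatrix (R : M3) : M3 := (1 - R.trace) • (1 : M3) + R + Rᵀ

theorem axisMatrix_transpose (R : M3) : (axisMatrix R)ᵀ = axisMatrix R := by
  simp only [axisMatrix, transpose_add, transpose_smul, transpose_one, transpose_transpose]
  abel

theorem axisMatrix_trace (R : M3) : (axisMatrix R).trace = 3 - R.trace := by
  simp [axisMatrix, trace_add, trace_smul]
  ring

theorem SO3.axisMatrix_mul_self {R : M3} (hR : SO3 R) :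
    axisMatrix R * axisMatrix R = (3 - R.trace) • axisMatrix R := by
  have hsq : R * R = Rᵀ + R.trace • R - R.trace • (1 : M3) := by
    have h := adjugate_eq_sq_sub R
    rw [hR.adjugate_eq_transpose, trace_transpose] at h
    rw [h]
    abel
  have hsqT : Rᵀ * Rᵀ = R + R.trace • Rᵀ - R.trace • (1 : M3) := by
    simpa using congrArg transpose hsq
  have hRRT : R * Rᵀ = 1 := mul_eq_one_comm.mp hR.1
  simp only [axisMatrix, Matrix.add_mul, Matrix.mul_add, Matrix.smul_mul, Matrix.mul_smul,
    Matrix.one_mul, Matrix.mul_one, hsq, hsqT, hRRT, hR.1]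
  module

theorem SO3.trace_mul_axisMatrix_nonneg {R C : M3} (hR : SO3 R) (hC : C.PosSemidef) :
    0 ≤ (C * axisMatrix R).trace := by
  have hP := hR.axisMatrix_mul_self
  have hH : (axisMatrix R)ᴴ = axisMatrix R := by
    rw [conjTranspose_eq_transpose_of_trivial, axisMatrix_transpose]
  rcases hR.trace_le_three.eq_or_lt with h | h
  · have h0 : axisMatrix R = 0 := by
      rw [h, sub_self, zero_smul] at hP
      rwa [← conjTranspose_mul_self_eq_zero, hH]
    simp [h0]
  · have hn := (hC.conjTranspose_mul_mul_same (axisMatrix R)).trace_nonneg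
    rw [hH, trace_mul_comm, ← Matrix.mul_assoc, hP, Matrix.smul_mul, trace_smul,
      trace_mul_comm, smul_eq_mul] at hn
    exact nonneg_of_mul_nonneg_right hn (sub_pos.mpr h)

theorem trace_mul_one_sub_eq {A : M3} (hA : A.IsSymm) (R : M3) :
    (A * (1 - R)).trace = (Abar A * axisMatrix R).trace := by
  have hT : (A * Rᵀ).trace = (A * R).trace := by
    rw [← trace_transpose, transpose_mul, transpose_transpose, hA.eq, trace_mul_comm]
  simp only [Abar, axisMatrix, Matrix.mul_add, Matrix.sub_mul, Matrix.mul_sub, Matrix.smul_mul,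
    Matrix.mul_smul, Matrix.one_mul, Matrix.mul_one, trace_add, trace_sub, trace_smul, trace_one,
    trace_transpose, hT, smul_eq_mul, Fintype.card_fin]
  push_cast
  ring

theorem posSemidef_sub_lmin {B : M3} (hB : B.PosDef) : (B - lmin hB • (1 : M3)).PosSemidef := by
  rw [posSemidef_iff_isHermitian_and_spectrum_nonneg]
  refine ⟨hB.1.sub (by simp [IsHermitian]), fun x hx => ?_⟩
  rw [← Algebra.algebraMap_eq_smul_one, ← spectrum.sub_singleton_eq,
    hB.1.spectrum_real_eq_range_eigenvalues] at hx
  obtain ⟨_, ⟨i, rfl⟩, _, rfl, rfl⟩ := hx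
  exact sub_nonneg.mpr (ciInf_le (Set.finite_range hB.1.eigenvalues).bddBelow i)

theorem posSemidef_lmax_sub {B : M3} (hB : B.PosDef) : (lmax hB • (1 : M3) - B).PosSemidef := by
  rw [posSemidef_iff_isHermitian_and_spectrum_nonneg]
  refine ⟨IsHermitian.sub (by simp [IsHermitian]) hB.1, fun x hx => ?_⟩
  rw [← Algebra.algebraMap_eq_smul_one, ← spectrum.singleton_sub_eq,
    hB.1.spectrum_real_eq_range_eigenvalues] at hx
  obtain ⟨_, rfl, _, ⟨i, rfl⟩, rfl⟩ := hx
  exact sub_nonneg.mpr (le_ciSup (Set.finite_range hB.1.eigenvalues).bddAbove i)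

/-- `4 λ_min(Ā) |R|_I² ≤ tr(A(I − R)) ≤ 4 λ_max(Ā) |R|_I²`. -/
theorem stmt1 (A : M3) (hA : A.IsSymm) (hPD : (Abar A).PosDef)
    (R : M3) (hR : SO3 R) :
    4 * lmin hPD * normI2 R ≤ (A * (1 - R)).trace ∧
    (A * (1 - R)).trace ≤ 4 * lmax hPD * normI2 R := by
  have hlo := hR.trace_mul_axisMatrix_nonneg (posSemidef_sub_lmin hPD)
  have hhi := hR.trace_mul_axisMatrix_nonneg (posSemidef_lmax_sub hPD)
  have hN : 4 * normI2 R = 3 - R.trace := by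
    simp [normI2, trace_sub]
    ring
  rw [Matrix.sub_mul, trace_sub, Matrix.smul_mul, Matrix.one_mul, trace_smul, axisMatrix_trace,
    ← hN, smul_eq_mul] at hlo hhi
  rw [trace_mul_one_sub_eq hA]
  constructor <;> linarith

end
end

section
/- Let A be a symmetric real 3×3 matrix such that Ā = (tr(A)I − A)/2 is positive definite, with largest eigenvalue λ_max. Let R̃ : [0,∞) → ℝ^{3×3} be differentiable with R̃(t) ∈ SO(3) and R̃'(t) = R̃(t)[σ(t)]_× where σ(t) = −ψ(A R̃(t)), and suppose 0 < |R̃(0)|_I < 1. Let 0 < B < 1. Then every time t_B ≥ 0 at which |R̃(t_B)|_I ≤ B satisfies t_B ≥ (1/λ_max) ln( |R̃(0)|_I (1 − B²)^{1/2} / (B (1 − |R̃(0)|_I²)^{1/2}) ). -/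
open Matrix Filter

noncomputable section

attribute [local instance] Matrix.normedAddCommGroup Matrix.normedSpace

theorem det_one_adjugate_eq_transpose {R : M3} (h : SO3 R) : R.adjugate = Rᵀ := by
  obtain ⟨h1, h2⟩ := h
  calc R.adjugate = (Rᵀ * R) * R.adjugate := by rw [h1, one_mul]
    _ = Rᵀ := by rw [Matrix.mul_assoc, mul_adjugate, h2, one_smul, mul_one]

theorem psi_dotProduct_self {R : M3} (h : SO3 R) :
    psi R ⬝ᵥ psi R = 4 * normI2 R * (1 - normI2 R) := by
  have ha := det_one_adjugate_eq_transpose h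
  have hN := h.1
  rw [adjugate_fin_three] at ha
  have a0 := congrFun (congrFun ha 0) 0
  have a1 := congrFun (congrFun ha 1) 1
  have a2 := congrFun (congrFun ha 2) 2
  have n0 := congrFun (congrFun hN 0) 0
  have n1 := congrFun (congrFun hN 1) 1
  have n2 := congrFun (congrFun hN 2) 2
  simp [mul_apply, Fin.sum_univ_three] at a0 a1 a2 n0 n1 n2
  simp [psi, vex, Pa, normI2, dotProduct, trace, Fin.sum_univ_three]
  linear_combination (1/4) * (n0 + n1 + n2) + (1/2) * (a0 + a1 + a2)

theorem psi_dotProduct_psi_mul {A R : M3} (hA : A.IsSymm) (h : SO3 R) :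
    psi R ⬝ᵥ psi (A * R) = psi R ⬝ᵥ (Abar A *ᵥ psi R) := by
  have hN : R * Rᵀ = Rᵀ * R := by rw [h.1, mul_eq_one_comm.mp h.1]
  have hn (i j) := congrFun (congrFun hN i) j
  have n00 := hn 0 0
  have n01 := hn 0 1
  have n02 := hn 0 2
  have n11 := hn 1 1
  have n12 := hn 1 2
  have n22 := hn 2 2
  have s01 := hA.apply 0 1
  have s02 := hA.apply 0 2
  have s12 := hA.apply 1 2
  simp [mul_apply, Fin.sum_univ_three] at n00 n01 n02 n11 n12 n22
  simp [psi, vex, Pa, Abar, dotProduct, mulVec, trace, mul_apply, Fin.sum_univ_three, one_apply,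
    s01, s02, s12]
  linear_combination (1/8) * (A 0 0 * n00 + A 1 1 * n11 + A 2 2 * n22 + 2 * A 0 1 * n01
    + 2 * A 0 2 * n02 + 2 * A 1 2 * n12)

theorem trace_mul_skew (R : M3) (v : V3) : (R * skew v).trace = -2 * (psi R ⬝ᵥ v) := by
  simp [psi, vex, Pa, skew, dotProduct, trace, mul_apply, Fin.sum_univ_three]
  ring

theorem dotProduct_mulVec_le_lmax {B : M3} (hB : B.PosDef) (x : V3) :
    x ⬝ᵥ (B *ᵥ x) ≤ lmax hB * (x ⬝ᵥ x) := by
  set U : M3 := (hB.1.eigenvectorUnitary : M3)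
  have hUU : U * Uᵀ = 1 := by
    simpa [star_eq_conjTranspose] using Unitary.coe_mul_star_self hB.1.eigenvectorUnitary
  have hspec : B = U * diagonal hB.1.eigenvalues * Uᵀ := by
    simpa [Unitary.conjStarAlgAut_apply, star_eq_conjTranspose, Function.comp_def] using
      hB.1.spectral_theorem
  have hx : x ⬝ᵥ x = (Uᵀ *ᵥ x) ⬝ᵥ (Uᵀ *ᵥ x) := by
    rw [dotProduct_mulVec, vecMul_transpose, mulVec_mulVec, hUU, one_mulVec]
  have hBx : x ⬝ᵥ (B *ᵥ x) =
      (Uᵀ *ᵥ x) ⬝ᵥ (diagonal hB.1.eigenvalues *ᵥ (Uᵀ *ᵥ x)) := by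
    conv_lhs => rw [hspec, ← mulVec_mulVec, ← mulVec_mulVec, dotProduct_mulVec]
    rw [mulVec_transpose]
  rw [hx, hBx, dotProduct, dotProduct, Finset.mul_sum]
  refine Finset.sum_le_sum fun i _ => ?_
  have hi : hB.1.eigenvalues i ≤ lmax hB := le_ciSup (Set.finite_range _).bddAbove i
  rw [mulVec_diagonal]
  nlinarith [mul_le_mul_of_nonneg_right hi (mul_self_nonneg ((Uᵀ *ᵥ x) i))]

theorem lmax_pos {B : M3} (hB : B.PosDef) : 0 < lmax hB :=
  (hB.eigenvalues_pos 0).trans_le (le_ciSup (Set.finite_range _).bddAbove 0)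

theorem hasDerivWithinAt_trace {f : ℝ → M3} {f' : M3} {s : Set ℝ} {t : ℝ}
    (h : HasDerivWithinAt f f' s t) : HasDerivWithinAt (fun t => (f t).trace) f'.trace s t := by
  have h1 (i) := hasDerivWithinAt_pi.1 (hasDerivWithinAt_pi.1 h i) i
  simp only [trace, Fin.sum_univ_three, diag]
  exact ((h1 0).add (h1 1)).add (h1 2)

theorem hasDerivWithinAt_normI2 {f : ℝ → M3} {f' : M3} {s : Set ℝ} {t : ℝ}
    (h : HasDerivWithinAt f f' s t) :
    HasDerivWithinAt (fun t => normI2 (f t)) (-f'.trace / 4) s t := by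
  simp only [normI2, trace_sub]
  exact ((hasDerivWithinAt_trace h).const_sub _).div_const 4

/-- If `-2 * c * e * (1 - e) ≤ e' ≤ 0` on `[0, ∞)` and `e 0 < 1`, the odds ratio
`e / (1 - e)` decays at most at the exponential rate `2 * c`. -/
theorem odds_mul_exp_le_of_logistic_bound {e e' : ℝ → ℝ} {c : ℝ}
    (he : ∀ t, 0 ≤ t → HasDerivWithinAt e (e' t) (Set.Ici 0) t)
    (hnonpos : ∀ t, 0 ≤ t → e' t ≤ 0)
    (hlower : ∀ t, 0 ≤ t → -(2 * c * (e t * (1 - e t))) ≤ e' t)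
    (h0 : e 0 < 1) {t : ℝ} (ht : 0 ≤ t) :
    e t < 1 ∧ e 0 / (1 - e 0) ≤ e t / (1 - e t) * Real.exp (2 * c * t) := by
  have hanti : AntitoneOn e (Set.Ici 0) :=
    antitoneOn_of_hasDerivWithinAt_nonpos (convex_Ici 0)
      (fun x hx => (he x hx).continuousWithinAt)
      (fun x hx => (he x (interior_subset hx)).mono interior_subset)
      (fun x hx => hnonpos x (interior_subset hx))
  have hlt (s : ℝ) (hs : 0 ≤ s) : e s < 1 :=
    (hanti Set.self_mem_Ici hs hs).trans_lt h0
  have hd (s : ℝ) (hs : 0 ≤ s) :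
      HasDerivWithinAt (fun s => e s / (1 - e s) * Real.exp (2 * c * s))
        ((e' s + 2 * c * (e s * (1 - e s))) / (1 - e s) ^ 2 * Real.exp (2 * c * s))
        (Set.Ici 0) s := by
    have hne : 1 - e s ≠ 0 := (sub_pos.2 (hlt s hs)).ne'
    have hexp : HasDerivWithinAt (fun s => Real.exp (2 * c * s))
        (Real.exp (2 * c * s) * (2 * c)) (Set.Ici 0) s := by
      simpa using ((hasDerivAt_id s).const_mul (2 * c)).exp.hasDerivWithinAt
    refine (((he s hs).div ((he s hs).const_sub 1) hne).mul hexp).congr_deriv ?_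
    simp only [Pi.div_apply]
    field_simp
    ring
  have hmono : MonotoneOn (fun s => e s / (1 - e s) * Real.exp (2 * c * s)) (Set.Ici 0) := by
    refine monotoneOn_of_hasDerivWithinAt_nonneg (convex_Ici 0)
      (fun x hx => (hd x hx).continuousWithinAt)
      (fun x hx => (hd x (interior_subset hx)).mono interior_subset) (fun x hx => ?_)
    have := hlower x (interior_subset hx)
    exact mul_nonneg (div_nonneg (by linarith) (sq_nonneg _)) (Real.exp_pos _).le
  exact ⟨hlt t ht, by simpa using hmono Set.self_mem_Ici ht ht⟩

/-- lower bound on the time needed to enter the ball of radius `B`. -/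
theorem stmt12 (A : M3) (hA : A.IsSymm) (hPD : (Abar A).PosDef)
    (Rt : ℝ → M3) (σ : ℝ → V3) (hσ : ∀ t, σ t = -psi (A * Rt t))
    (hSO : ∀ t, 0 ≤ t → SO3 (Rt t))
    (hR' : ∀ t, 0 ≤ t → HasDerivWithinAt Rt (Rt t * skew (σ t)) (Set.Ici 0) t)
    (h0pos : 0 < normI2 (Rt 0)) (h0 : normI2 (Rt 0) < 1)
    (B : ℝ) (hB0 : 0 < B) (hB1 : B < 1) :
    ∀ tB, 0 ≤ tB → Real.sqrt (normI2 (Rt tB)) ≤ B →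
      (1 / lmax hPD) *
          Real.log (Real.sqrt (normI2 (Rt 0)) * Real.sqrt (1 - B ^ 2) /
            (B * Real.sqrt (1 - normI2 (Rt 0)))) ≤ tB := by
  intro t ht hle
  have hderiv (s : ℝ) (hs : 0 ≤ s) :
      HasDerivWithinAt (fun s => normI2 (Rt s))
        (-(psi (Rt s) ⬝ᵥ (Abar A *ᵥ psi (Rt s))) / 2) (Set.Ici 0) s := by
    refine (hasDerivWithinAt_normI2 (hR' s hs)).congr_deriv ?_
    rw [trace_mul_skew, hσ, dotProduct_neg, psi_dotProduct_psi_mul hA (hSO s hs)]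
    ring
  obtain ⟨hlt, hodds⟩ := odds_mul_exp_le_of_logistic_bound (c := lmax hPD) hderiv
    (fun s _ => by
      have := hPD.posSemidef.dotProduct_mulVec_nonneg (psi (Rt s))
      simp only [star_trivial] at this
      linarith)
    (fun s hs => by
      have := dotProduct_mulVec_le_lmax hPD (psi (Rt s))
      rw [psi_dotProduct_self (hSO s hs)] at this
      linarith)
    h0 ht
  have hB2 : 0 < 1 - B ^ 2 := by nlinarith
  have he : normI2 (Rt t) ≤ B ^ 2 := (Real.sqrt_le_left hB0.le).1 hle
  have hq : normI2 (Rt t) / (1 - normI2 (Rt t)) ≤ B ^ 2 / (1 - B ^ 2) := by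
    rw [div_le_div_iff₀ (sub_pos.2 hlt) hB2]
    nlinarith
  have h1 : 0 < 1 - normI2 (Rt 0) := sub_pos.2 h0
  have hfin : normI2 (Rt 0) / (1 - normI2 (Rt 0)) ≤
      B ^ 2 / (1 - B ^ 2) * Real.exp (2 * lmax hPD * t) :=
    hodds.trans (mul_le_mul_of_nonneg_right hq (Real.exp_pos _).le)
  have hexp : Real.exp (2 * lmax hPD * t) = Real.exp (lmax hPD * t) ^ 2 := by
    rw [← Real.exp_nat_mul]
    congr 1
    push_cast
    ring
  have hs0 := Real.sqrt_pos.2 h0pos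
  have hs1 := Real.sqrt_pos.2 h1
  have hs2 := Real.sqrt_pos.2 hB2
  rw [one_div, inv_mul_le_iff₀ (lmax_pos hPD),
    Real.log_le_iff_le_exp (div_pos (mul_pos hs0 hs2) (mul_pos hB0 hs1))]
  refine le_of_sq_le_sq ?_ (Real.exp_pos _).le
  rw [← hexp, div_pow, mul_pow, mul_pow, Real.sq_sqrt h0pos.le, Real.sq_sqrt h1.le,
    Real.sq_sqrt hB2.le, div_le_iff₀ (by positivity)]
  rw [div_mul_eq_mul_div, div_le_div_iff₀ h1 hB2] at hfin
  linarith

end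
end
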